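/- Let Π be an ordered logic program over language 𝓛 and X a set of literals. If X = Y ∩ 𝓛 for some answer set Y of 𝒯(Π), then X is an answer set of TA(Π). -/

import Mathlib

set_option autoImplicit false

namespace ASP

/-- Literals over a set of atoms: an atom or its classical negation. -/
inductive Lit (α : Type) : Type
  | pos : α → Lit α
  | neg : α → Lit α

namespace Lit

/-- The atom of a literal. -/
def atom {α : Type} : Lit α → α
  | pos a => a
  | neg a => a

/-- Map a function over the atom of a literal. -/
def map {α β : Type} (f : α → β) : Lit α → Lit β
  | pos a => pos (f a)
  | neg a => neg (f a)

end Lit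

/-- A rule `head ← bodyP, not bodyN`. -/
structure Rule (α : Type) : Type where
  head : Lit α
  bodyP : Set (Lit α)
  bodyN : Set (Lit α)

/-- Map a function over the atoms of a rule. -/
def Rule.map {α β : Type} (f : α → β) (r : Rule α) : Rule β :=
  ⟨r.head.map f, Lit.map f '' r.bodyP, Lit.map f '' r.bodyN⟩

/-- The literals occurring in a rule. -/
def ruleLits {α : Type} (r : Rule α) : Set (Lit α) := insert r.head (r.bodyP ∪ r.bodyN)

/-- A set of literals is consistent iff it contains no complementary pair. -/
def consistent {α : Type} (X : Set (Lit α)) : Prop := ¬ ∃ a, Lit.pos a ∈ X ∧ Lit.neg a ∈ X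

/-- Logically closed: consistent or the set of all literals. -/
def logClosed {α : Type} (X : Set (Lit α)) : Prop := consistent X ∨ X = Set.univ

/-- The smallest logically closed set of literals containing `S`. -/
def logClosure {α : Type} (S : Set (Lit α)) : Set (Lit α) := ⋂₀ {Y | S ⊆ Y ∧ logClosed Y}

/-- `X` is closed under the (basic) program `P`. -/
def closedUnder {α : Type} (P : Set (Rule α)) (X : Set (Lit α)) : Prop :=
  ∀ r ∈ P, r.bodyP ⊆ X → r.head ∈ X

/-- `Th P`: smallest set which is logically closed and closed under the basic program `P`. -/
def Th {α : Type} (P : Set (Rule α)) : Set (Lit α) := ⋂₀ {X | logClosed X ∧ closedUnder P X}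

/-- A rule is defeated by `X` iff `bodyN r ∩ X ≠ ∅`. -/
def defeated {α : Type} (r : Rule α) (X : Set (Lit α)) : Prop := ∃ L ∈ r.bodyN, L ∈ X

/-- The Gelfond-Lifschitz reduct of `P` relative to `X`. -/
def reduct {α : Type} (P : Set (Rule α)) (X : Set (Lit α)) : Set (Rule α) :=
  {r' | ∃ r ∈ P, ¬ defeated r X ∧ r' = Rule.mk r.head r.bodyP ∅}

/-- `X` is an answer set of `P` iff `Th (P^X) = X`. -/
def answerSet {α : Type} (P : Set (Rule α)) (X : Set (Lit α)) : Prop := Th (reduct P X) = X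

/-- Generating rules of `X` from `P`. -/
def GR {α : Type} (P : Set (Rule α)) (X : Set (Lit α)) : Set (Rule α) :=
  {r | r ∈ P ∧ r.bodyP ⊆ X ∧ ¬ defeated r X}

/-- Heads of the rules occurring before position `i` in the list `l`. -/
def headsBefore {α : Type} (l : List (Rule α)) (i : ℕ) : Set (Lit α) :=
  {L | L ∈ (l.take i).map Rule.head}

/-- The sequence of rules `l` is grounded. -/
def groundedList {α : Type} (l : List (Rule α)) : Prop :=
  ∀ (i : ℕ) (h : i < l.length),
    consistent (headsBefore l i) → (l.get ⟨i, h⟩).bodyP ⊆ headsBefore l i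

/-- `l` is an enumeration of the set `S` of rules. -/
def enumerates {α : Type} (l : List (Rule α)) (S : Set (Rule α)) : Prop :=
  l.Nodup ∧ {r | r ∈ l} = S

/-- The one-step consequence operator for basic programs. -/
def TOp {α : Type} (P : Set (Rule α)) (X : Set (Lit α)) : Set (Lit α) :=
  {L | (consistent X ∧ ∃ r ∈ P, r.bodyP ⊆ X ∧ r.head = L) ∨ ¬ consistent X}

/-- Iterated application of `TOp`, starting from `∅`. -/
def TIter {α : Type} (P : Set (Rule α)) : ℕ → Set (Lit α)
  | 0 => ∅
  | n + 1 => TOp P (TIter P n)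

/-- A strict partial order whose field is contained in `P`. -/
def strictOn {γ : Type} (P : Set γ) (lt : γ → γ → Prop) : Prop :=
  (∀ a b, lt a b → a ∈ P ∧ b ∈ P) ∧ (∀ a b c, lt a b → lt b c → lt a c) ∧ (∀ a, ¬ lt a a)

/-- A total strict order on `P`. -/
def totalStrictOn {γ : Type} (P : Set γ) (ll : γ → γ → Prop) : Prop :=
  (∀ a b, ll a b → a ∈ P ∧ b ∈ P) ∧ (∀ a b c, ll a b → ll b c → ll a c) ∧
    (∀ a, ¬ ll a a) ∧ (∀ a ∈ P, ∀ b ∈ P, a ≠ b → ll a b ∨ ll b a)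

/-! ## Ordered logic programs -/

/-- Atoms of the language of an ordered logic program: regular atoms and
preference atoms `n ≺ m` over names. -/
inductive OAtom (α N : Type) : Type
  | reg : α → OAtom α N
  | pref : N → N → OAtom α N

/-- Rules of an ordered logic program. -/
abbrev ORule (α N : Type) := Rule (OAtom α N)

/-- The preference literal `(n ≺ m)`. -/
def prefLit {α N : Type} (n m : N) : Lit (OAtom α N) := Lit.pos (OAtom.pref n m)

/-- A literal over a regular atom. -/
def regLitO {α N : Type} (L : Lit (OAtom α N)) : Prop := ∃ a, L.atom = OAtom.reg a

/-- No preference atom occurs in the rule `r`. -/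
def noPref {α N : Type} (r : ORule α N) : Prop := ∀ L ∈ ruleLits r, regLitO L

/-- The dynamically induced preference `r <_X r'`, at the level of the language `𝓛`. -/
def precXO {α N : Type} (nm : ORule α N → N) (X : Set (Lit (OAtom α N)))
    (r s : ORule α N) : Prop :=
  prefLit (nm r) (nm s) ∈ X

/-- The fact `(n_r ≺ n_s) ←`. -/
def prefFactO {α N : Type} (nm : ORule α N → N) (r s : ORule α N) : ORule α N :=
  ⟨prefLit (nm r) (nm s), ∅, ∅⟩

/-- The transitivity rule `t(r,s,t)`. -/
def tRuleO {α N : Type} (nm : ORule α N → N) (r s t : ORule α N) : ORule α N :=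
  ⟨prefLit (nm r) (nm t), {prefLit (nm r) (nm s), prefLit (nm s) (nm t)}, ∅⟩

/-- The antisymmetry rule `as(r,s)`. -/
def asRuleO {α N : Type} (nm : ORule α N → N) (r s : ORule α N) : ORule α N :=
  ⟨Lit.neg (OAtom.pref (nm s) (nm r)), {prefLit (nm r) (nm s)}, ∅⟩

/-- `TA(Π)`: `Π` together with all transitivity and antisymmetry rules. -/
def TA {α N : Type} (P : Set (ORule α N)) (nm : ORule α N → N) : Set (ORule α N) :=
  P ∪ {ru | ∃ r ∈ P, ∃ s ∈ P, ∃ t ∈ P, ru = tRuleO nm r s t}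
    ∪ {ru | ∃ r ∈ P, ∃ s ∈ P, ru = asRuleO nm r s}

/-- The statically ordered program `(Π,<)`, identified with
`Π ∪ {(n_r ≺ n_{r'}) ← ∣ r < r'}`. -/
def staticProg {α N : Type} (P : Set (ORule α N)) (nm : ORule α N → N)
    (lt : ORule α N → ORule α N → Prop) : Set (ORule α N) :=
  P ∪ {ru | ∃ r ∈ P, ∃ s ∈ P, lt r s ∧ ru = prefFactO nm r s}

/-- The heads of the generating rules occurring before position `i` in `l`. -/
def grHeadsBefore {α : Type} (l : List (Rule α)) (G : Set (Rule α)) (i : ℕ) :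
    Set (Lit α) :=
  {L | ∃ j, ∃ h : j < l.length, j < i ∧ l.get ⟨j, h⟩ ∈ G ∧ (l.get ⟨j, h⟩).head = L}

/-- `X` is a `<`-preserving answer set of the statically ordered program `(P,lt)`
(Definition 1). -/
def staticPreserving {α N : Type} (P : Set (ORule α N))
    (lt : ORule α N → ORule α N → Prop) (X : Set (Lit (OAtom α N))) : Prop :=
  answerSet P X ∧ consistent X ∧
    ∃ l : List (ORule α N), enumerates l (GR P X) ∧
      (∀ (i : ℕ) (h : i < l.length), (l.get ⟨i, h⟩).bodyP ⊆ headsBefore l i) ∧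
      (∀ (i j : ℕ) (hi : i < l.length) (hj : j < l.length),
        lt (l.get ⟨i, hi⟩) (l.get ⟨j, hj⟩) → j < i) ∧
      (∀ (i : ℕ) (hi : i < l.length), ∀ r' ∈ P, r' ∉ GR P X →
        lt (l.get ⟨i, hi⟩) r' →
          ¬ r'.bodyP ⊆ X ∨ ∃ L ∈ r'.bodyN, L ∈ headsBefore l i)

/-- `X` is a `<_X`-preserving answer set of the program `P` (standing for `TA(Π)`;
Definition 3). -/
def dynPreserving {α N : Type} (nm : ORule α N → N) (P : Set (ORule α N))
    (X : Set (Lit (OAtom α N))) : Prop :=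
  answerSet P X ∧ consistent X ∧
    ∃ l : List (ORule α N), enumerates l P ∧
      (∀ (i j : ℕ) (hi : i < l.length) (hj : j < l.length),
        precXO nm X (l.get ⟨i, hi⟩) (l.get ⟨j, hj⟩) → j < i) ∧
      (∀ (i j : ℕ) (hi : i < l.length) (hj : j < l.length),
        precXO nm X (l.get ⟨i, hi⟩) (l.get ⟨j, hj⟩) →
          ∃ k, ∃ hk : k < l.length, k < i ∧ l.get ⟨k, hk⟩ ∈ GR P X ∧
            (l.get ⟨k, hk⟩).head = prefLit (nm (l.get ⟨i, hi⟩)) (nm (l.get ⟨j, hj⟩))) ∧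
      (∀ (i : ℕ) (hi : i < l.length), l.get ⟨i, hi⟩ ∈ GR P X →
        (l.get ⟨i, hi⟩).bodyP ⊆ grHeadsBefore l (GR P X) i) ∧
      (∀ (i : ℕ) (hi : i < l.length), l.get ⟨i, hi⟩ ∉ GR P X →
        ¬ (l.get ⟨i, hi⟩).bodyP ⊆ X ∨
          ∃ L ∈ (l.get ⟨i, hi⟩).bodyN, L ∈ grHeadsBefore l (GR P X) i)

/-- Occurrence of a name in a rule (inside some preference atom). -/
def nameOccurs {α N : Type} (n : N) (r : ORule α N) : Prop :=
  ∃ L ∈ ruleLits r, ∃ m, L.atom = OAtom.pref n m ∨ L.atom = OAtom.pref m n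

/-! ## The translation 𝒯 -/

/-- Atoms of the target language `𝓛⁺` of the translation `𝒯`. -/
inductive TAtom (α N : Type) : Type
  | old : OAtom α N → TAtom α N
  | ap : N → TAtom α N
  | bl : N → TAtom α N
  | ok : N → TAtom α N
  | rdy : N → N → TAtom α N

/-- Embedding of `𝓛`-literals into `𝓛⁺`. -/
def oldLit {α N : Type} (L : Lit (OAtom α N)) : Lit (TAtom α N) := L.map TAtom.old

/-- The preference literal `(n ≺ m)` inside `𝓛⁺`. -/
def tpref {α N : Type} (n m : N) : Lit (TAtom α N) := Lit.pos (TAtom.old (OAtom.pref n m))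

def apLit {α N : Type} (n : N) : Lit (TAtom α N) := Lit.pos (TAtom.ap n)
def blLit {α N : Type} (n : N) : Lit (TAtom α N) := Lit.pos (TAtom.bl n)
def okLit {α N : Type} (n : N) : Lit (TAtom α N) := Lit.pos (TAtom.ok n)
def rdyLit {α N : Type} (n m : N) : Lit (TAtom α N) := Lit.pos (TAtom.rdy n m)

/-- `a1(r) : head(r) ← ap(n_r)`. -/
def a1Rule {α N : Type} (nm : ORule α N → N) (r : ORule α N) : Rule (TAtom α N) :=
  ⟨oldLit r.head, {apLit (nm r)}, ∅⟩

/-- `a2(r) : ap(n_r) ← ok(n_r), body(r)`. -/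
def a2Rule {α N : Type} (nm : ORule α N → N) (r : ORule α N) : Rule (TAtom α N) :=
  ⟨apLit (nm r), insert (okLit (nm r)) (oldLit '' r.bodyP), oldLit '' r.bodyN⟩

/-- `b1(r,L⁺) : bl(n_r) ← ok(n_r), not L⁺`. -/
def b1Rule {α N : Type} (nm : ORule α N → N) (r : ORule α N) (L : Lit (OAtom α N)) :
    Rule (TAtom α N) :=
  ⟨blLit (nm r), {okLit (nm r)}, {oldLit L}⟩

/-- `b2(r,L⁻) : bl(n_r) ← ok(n_r), L⁻`. -/
def b2Rule {α N : Type} (nm : ORule α N → N) (r : ORule α N) (L : Lit (OAtom α N)) :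
    Rule (TAtom α N) :=
  ⟨blLit (nm r), {okLit (nm r), oldLit L}, ∅⟩

/-- `c1(r) : ok(n_r) ← rdy(n_r,n_{r_1}), …, rdy(n_r,n_{r_k})`. -/
def c1Rule {α N : Type} (P : Set (ORule α N)) (nm : ORule α N → N) (r : ORule α N) :
    Rule (TAtom α N) :=
  ⟨okLit (nm r), {L | ∃ s ∈ P, L = rdyLit (nm r) (nm s)}, ∅⟩

/-- `c2(r,s) : rdy(n_r,n_s) ← not (n_r ≺ n_s)`. -/
def c2Rule {α N : Type} (nm : ORule α N → N) (r s : ORule α N) : Rule (TAtom α N) :=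
  ⟨rdyLit (nm r) (nm s), ∅, {tpref (nm r) (nm s)}⟩

/-- `c3(r,s) : rdy(n_r,n_s) ← (n_r ≺ n_s), ap(n_s)`. -/
def c3Rule {α N : Type} (nm : ORule α N → N) (r s : ORule α N) : Rule (TAtom α N) :=
  ⟨rdyLit (nm r) (nm s), {tpref (nm r) (nm s), apLit (nm s)}, ∅⟩

/-- `c4(r,s) : rdy(n_r,n_s) ← (n_r ≺ n_s), bl(n_s)`. -/
def c4Rule {α N : Type} (nm : ORule α N → N) (r s : ORule α N) : Rule (TAtom α N) :=
  ⟨rdyLit (nm r) (nm s), {tpref (nm r) (nm s), blLit (nm s)}, ∅⟩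

/-- `t(r,s,t) : (n_r ≺ n_t) ← (n_r ≺ n_s), (n_s ≺ n_t)` inside `𝓛⁺`. -/
def tRuleT {α N : Type} (nm : ORule α N → N) (r s t : ORule α N) : Rule (TAtom α N) :=
  ⟨tpref (nm r) (nm t), {tpref (nm r) (nm s), tpref (nm s) (nm t)}, ∅⟩

/-- `as(r,s) : ¬(n_s ≺ n_r) ← (n_r ≺ n_s)` inside `𝓛⁺`. -/
def asRuleT {α N : Type} (nm : ORule α N → N) (r s : ORule α N) : Rule (TAtom α N) :=
  ⟨Lit.neg (TAtom.old (OAtom.pref (nm s) (nm r))), {tpref (nm r) (nm s)}, ∅⟩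

/-- The set of rules `τ(r)` of Definition 2. -/
def tau {α N : Type} (P : Set (ORule α N)) (nm : ORule α N → N) (r : ORule α N) :
    Set (Rule (TAtom α N)) :=
  {a1Rule nm r, a2Rule nm r, c1Rule P nm r}
    ∪ {ru | ∃ L ∈ r.bodyP, ru = b1Rule nm r L}
    ∪ {ru | ∃ L ∈ r.bodyN, ru = b2Rule nm r L}
    ∪ {ru | ∃ s ∈ P, ru = c2Rule nm r s ∨ ru = c3Rule nm r s ∨ ru = c4Rule nm r s}
    ∪ {ru | ∃ s ∈ P, ∃ t ∈ P, ru = tRuleT nm r s t}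
    ∪ {ru | ∃ s ∈ P, ru = asRuleT nm r s}

/-- The translation `𝒯(Π) = ⋃_{r ∈ Π} τ(r)`. -/
def TTrans {α N : Type} (P : Set (ORule α N)) (nm : ORule α N → N) :
    Set (Rule (TAtom α N)) :=
  {ru | ∃ r ∈ P, ru ∈ tau P nm r}

/-- `𝒯(Π,<)` for a statically ordered program. -/
def TStatic {α N : Type} (P : Set (ORule α N)) (nm : ORule α N → N)
    (lt : ORule α N → ORule α N → Prop) : Set (Rule (TAtom α N)) :=
  TTrans (staticProg P nm lt) nm

/-- The dynamically induced preference `r <_X r'` read off from an answer set of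
the translated program. -/
def precX {α N : Type} (nm : ORule α N → N) (X : Set (Lit (TAtom α N)))
    (r s : ORule α N) : Prop :=
  tpref (nm r) (nm s) ∈ X

/-- The literals of `𝓛⁺` over regular atoms (the set `𝓛_𝒜`). -/
def regLitsT {α N : Type} : Set (Lit (TAtom α N)) :=
  {L | ∃ a, L.atom = TAtom.old (OAtom.reg a)}

/-- The literals of `𝓛⁺` belonging to the original language `𝓛`. -/
def oldLitsT {α N : Type} : Set (Lit (TAtom α N)) := Set.range oldLit

/-- A rule of `𝒯(Π)` that is an "image" of `r ∈ Π`: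
`a2(r)`, or `b1(r,L)`/`b2(r,L)` for some body literal `L` of `r`. -/
def imgRule {α N : Type} (nm : ORule α N → N) (r : ORule α N)
    (ru : Rule (TAtom α N)) : Prop :=
  ru = a2Rule nm r ∨ (∃ L ∈ r.bodyP, ru = b1Rule nm r L) ∨
    (∃ L ∈ r.bodyN, ru = b2Rule nm r L)

/-! ## The translation 𝒰 (Brewka–Eiter encoding) -/

/-- Atoms of the target language `𝓛°` of the translation `𝒰`. -/
inductive UAtom (α N : Type) : Type
  | old : OAtom α N → UAtom α N
  | pr : OAtom α N → UAtom α N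
  | ap : N → UAtom α N
  | bl : N → UAtom α N
  | ok : N → UAtom α N
  | rdy : N → N → UAtom α N
  | de : N → UAtom α N

def uold {α N : Type} (L : Lit (OAtom α N)) : Lit (UAtom α N) := L.map UAtom.old
def uprimed {α N : Type} (L : Lit (OAtom α N)) : Lit (UAtom α N) := L.map UAtom.pr
def upref {α N : Type} (n m : N) : Lit (UAtom α N) := Lit.pos (UAtom.old (OAtom.pref n m))
def uapLit {α N : Type} (n : N) : Lit (UAtom α N) := Lit.pos (UAtom.ap n)
def ublLit {α N : Type} (n : N) : Lit (UAtom α N) := Lit.pos (UAtom.bl n)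
def uokLit {α N : Type} (n : N) : Lit (UAtom α N) := Lit.pos (UAtom.ok n)
def urdyLit {α N : Type} (n m : N) : Lit (UAtom α N) := Lit.pos (UAtom.rdy n m)
def udeLit {α N : Type} (n : N) : Lit (UAtom α N) := Lit.pos (UAtom.de n)

/-- `a1(r) : head(r') ← ap(n_r)`. -/
def ua1 {α N : Type} (nm : ORule α N → N) (r : ORule α N) : Rule (UAtom α N) :=
  ⟨uprimed r.head, {uapLit (nm r)}, ∅⟩

/-- `a2(r) : ap(n_r) ← ok(n_r), body(r), not body⁻(r')`. -/
def ua2 {α N : Type} (nm : ORule α N → N) (r : ORule α N) : Rule (UAtom α N) :=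
  ⟨uapLit (nm r), insert (uokLit (nm r)) (uold '' r.bodyP),
    uold '' r.bodyN ∪ uprimed '' r.bodyN⟩

/-- `b1(r,L) : bl(n_r) ← ok(n_r), not L, not L'`. -/
def ub1 {α N : Type} (nm : ORule α N → N) (r : ORule α N) (L : Lit (OAtom α N)) :
    Rule (UAtom α N) :=
  ⟨ublLit (nm r), {uokLit (nm r)}, {uold L, uprimed L}⟩

/-- `b2(r,K) : bl(n_r) ← ok(n_r), K, K'`. -/
def ub2 {α N : Type} (nm : ORule α N → N) (r : ORule α N) (K : Lit (OAtom α N)) :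
    Rule (UAtom α N) :=
  ⟨ublLit (nm r), {uokLit (nm r), uold K, uprimed K}, ∅⟩

/-- `c1(r) : ok(n_r) ← rdy(n_r,n_{r_1}), …, rdy(n_r,n_{r_k})`. -/
def uc1 {α N : Type} (P : Set (ORule α N)) (nm : ORule α N → N) (r : ORule α N) :
    Rule (UAtom α N) :=
  ⟨uokLit (nm r), {L | ∃ s ∈ P, L = urdyLit (nm r) (nm s)}, ∅⟩

/-- `c2(r,s) : rdy(n_r,n_s) ← not (n_r ≺ n_s)`. -/
def uc2 {α N : Type} (nm : ORule α N → N) (r s : ORule α N) : Rule (UAtom α N) :=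
  ⟨urdyLit (nm r) (nm s), ∅, {upref (nm r) (nm s)}⟩

/-- `c3(r,s) : rdy(n_r,n_s) ← (n_r ≺ n_s), ap(n_s)`. -/
def uc3 {α N : Type} (nm : ORule α N → N) (r s : ORule α N) : Rule (UAtom α N) :=
  ⟨urdyLit (nm r) (nm s), {upref (nm r) (nm s), uapLit (nm s)}, ∅⟩

/-- `c4(r,s) : rdy(n_r,n_s) ← (n_r ≺ n_s), bl(n_s)`. -/
def uc4 {α N : Type} (nm : ORule α N → N) (r s : ORule α N) : Rule (UAtom α N) :=
  ⟨urdyLit (nm r) (nm s), {upref (nm r) (nm s), ublLit (nm s)}, ∅⟩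

/-- `c5(r,s,J) : rdy(n_r,n_s) ← head(s), J`. -/
def uc5 {α N : Type} (nm : ORule α N → N) (r s : ORule α N) (J : Lit (OAtom α N)) :
    Rule (UAtom α N) :=
  ⟨urdyLit (nm r) (nm s), {uold s.head, uold J}, ∅⟩

/-- The constraint `de(r) : ← not ok(n_r)`, rendered as
`p_r ← not ok(n_r), not p_r` for the fresh atom `p_r = de(n_r)`. -/
def ude {α N : Type} (nm : ORule α N → N) (r : ORule α N) : Rule (UAtom α N) :=
  ⟨udeLit (nm r), ∅, {uokLit (nm r), udeLit (nm r)}⟩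

/-- Transitivity rule inside `𝓛°`. -/
def utr {α N : Type} (nm : ORule α N → N) (r s t : ORule α N) : Rule (UAtom α N) :=
  ⟨upref (nm r) (nm t), {upref (nm r) (nm s), upref (nm s) (nm t)}, ∅⟩

/-- Antisymmetry rule inside `𝓛°`. -/
def uas {α N : Type} (nm : ORule α N → N) (r s : ORule α N) : Rule (UAtom α N) :=
  ⟨Lit.neg (UAtom.old (OAtom.pref (nm s) (nm r))), {upref (nm r) (nm s)}, ∅⟩

/-- The set of rules `τ(r)` of Definition 8. -/
def utau {α N : Type} (P : Set (ORule α N)) (nm : ORule α N → N) (r : ORule α N) :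
    Set (Rule (UAtom α N)) :=
  {ua1 nm r, ua2 nm r, uc1 P nm r, ude nm r}
    ∪ {ru | ∃ L ∈ r.bodyP, ru = ub1 nm r L}
    ∪ {ru | ∃ K ∈ r.bodyN, ru = ub2 nm r K}
    ∪ {ru | ∃ s ∈ P, ru = uc2 nm r s ∨ ru = uc3 nm r s ∨ ru = uc4 nm r s}
    ∪ {ru | ∃ s ∈ P, ∃ J ∈ s.bodyN, ru = uc5 nm r s J}
    ∪ {ru | ∃ s ∈ P, ∃ t ∈ P, ru = utr nm r s t}
    ∪ {ru | ∃ s ∈ P, ru = uas nm r s}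

/-- The translation `𝒰(Π) = Π ∪ ⋃_{r ∈ Π} τ(r)`. -/
def UTrans {α N : Type} (P : Set (ORule α N)) (nm : ORule α N → N) :
    Set (Rule (UAtom α N)) :=
  (Rule.map UAtom.old) '' P ∪ {ru | ∃ r ∈ P, ru ∈ utau P nm r}

/-- The fact `(n_r ≺ n_s) ←` inside `𝓛°`. -/
def uPrefFact {α N : Type} (nm : ORule α N → N) (r s : ORule α N) : Rule (UAtom α N) :=
  ⟨upref (nm r) (nm s), ∅, ∅⟩

/-- The literals of `𝓛°` over regular atoms (the set `𝓛_𝒜`). -/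
def regLitsU {α N : Type} : Set (Lit (UAtom α N)) :=
  {L | ∃ a, L.atom = UAtom.old (OAtom.reg a)}

/-! ## Brewka–Eiter preferred answer sets -/

/-- `reductBE r = head(r) ← not body⁻(r)`. -/
def reductBE {γ : Type} (r : Rule γ) : Rule γ := ⟨r.head, ∅, r.bodyN⟩

/-- The sequence `X_i` of Definition 5 (for the enumeration `l` and the set `X`). -/
def CSeq {γ : Type} (l : List (Rule γ)) (X : Set (Lit γ)) : ℕ → Set (Lit γ)
  | 0 => ∅
  | i + 1 =>
    CSeq l X i ∪
      {L | ∃ h : i < l.length,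
        ¬ defeated (l.get ⟨i, h⟩) (CSeq l X i) ∧
        ¬ ((l.get ⟨i, h⟩).head ∈ X ∧ defeated (l.get ⟨i, h⟩) X) ∧
        L = (l.get ⟨i, h⟩).head}

/-- The operator `C` of Definition 5. -/
def COp {γ : Type} (l : List (Rule γ)) (X : Set (Lit γ)) : Set (Lit γ) :=
  logClosure (⋃ i, CSeq l X i)

/-- `l` is the enumeration of `P` according to the total order `ll`
(most preferred rule first). -/
def descList {γ : Type} (l : List (Rule γ)) (P : Set (Rule γ))
    (ll : Rule γ → Rule γ → Prop) : Prop :=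
  enumerates l P ∧
    ∀ (i j : ℕ) (hi : i < l.length) (hj : j < l.length), i < j →
      ll (l.get ⟨j, hj⟩) (l.get ⟨i, hi⟩)

/-- `X` is the BE-preferred answer set of the fully ordered prerequisite-free
program `(P,ll)`. -/
def BEPrefPF {γ : Type} (P : Set (Rule γ)) (ll : Rule γ → Rule γ → Prop)
    (X : Set (Lit γ)) : Prop :=
  ∃ l, descList l P ll ∧ COp l X = X

/-- The program `Π_X` of Definition 7. -/
def PiX {γ : Type} (P : Set (Rule γ)) (X : Set (Lit γ)) : Set (Rule γ) :=
  {r' | ∃ r ∈ P, r.bodyP ⊆ X ∧ r' = reductBE r}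

/-- `r` is the `ll`-maximal rule of `P` whose BE-reduct is `a`. -/
def beMax {γ : Type} (P : Set (Rule γ)) (ll : Rule γ → Rule γ → Prop)
    (a r : Rule γ) : Prop :=
  r ∈ P ∧ reductBE r = a ∧ ∀ s ∈ P, reductBE s = a → s = r ∨ ll s r

/-- The inherited order `ll_X` of Definition 7. -/
def llX {γ : Type} (P : Set (Rule γ)) (ll : Rule γ → Rule γ → Prop)
    (a b : Rule γ) : Prop :=
  ∃ r1 r2, beMax P ll a r1 ∧ beMax P ll b r2 ∧ ll r1 r2

/-- `X` is a BE-preferred answer set of the fully ordered program `(P,ll)`. -/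
def BEPrefFull {γ : Type} (P : Set (Rule γ)) (ll : Rule γ → Rule γ → Prop)
    (X : Set (Lit γ)) : Prop :=
  answerSet P X ∧ BEPrefPF (PiX P X) (llX P ll) X

/-- `X` is a BE-preferred answer set of the statically ordered program `(P,lt)`. -/
def BEPreferred {γ : Type} (P : Set (Rule γ)) (lt : Rule γ → Rule γ → Prop)
    (X : Set (Lit γ)) : Prop :=
  ∃ ll, totalStrictOn P ll ∧ (∀ a b, lt a b → ll a b) ∧ BEPrefFull P ll X

theorem consistent.mono {α : Type} {X Y : Set (Lit α)} (hY : consistent Y) (h : X ⊆ Y) :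
    consistent X :=
  fun ⟨a, hp, hn⟩ => hY ⟨a, h hp, h hn⟩

theorem logClosed_Th {α : Type} (P : Set (Rule α)) : logClosed (Th P) := by
  by_cases h : ∃ Z, consistent Z ∧ closedUnder P Z
  · obtain ⟨Z, hZ, hc⟩ := h
    exact Or.inl (hZ.mono (Set.sInter_subset_of_mem ⟨Or.inl hZ, hc⟩))
  · refine Or.inr (Set.eq_univ_of_forall fun L => ?_)
    rintro Z ⟨hZ | rfl, hc⟩
    · exact absurd ⟨Z, hZ, hc⟩ h
    · trivial

theorem closedUnder_Th {α : Type} (P : Set (Rule α)) : closedUnder P (Th P) :=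
  fun r hr hb Z hZ => hZ.2 r hr fun _ hL => hb hL Z hZ

/-- Closure under a reduct, expressed through the original rules. -/
theorem closedUnder_reduct_iff {α : Type} {P : Set (Rule α)} {X Z : Set (Lit α)} :
    closedUnder (reduct P X) Z ↔
      ∀ r ∈ P, ¬ defeated r X → r.bodyP ⊆ Z → r.head ∈ Z := by
  constructor
  · intro h r hr hd hb
    exact h ⟨r.head, r.bodyP, ∅⟩ ⟨r, hr, hd, rfl⟩ hb
  · rintro h _ ⟨r, hr, hd, rfl⟩ hb
    exact h r hr hd hb

theorem answerSet.logClosed {α : Type} {P : Set (Rule α)} {X : Set (Lit α)}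
    (h : answerSet P X) : logClosed X := by
  have := logClosed_Th (reduct P X)
  rwa [show Th (reduct P X) = X from h] at this

theorem answerSet.closed {α : Type} {P : Set (Rule α)} {X : Set (Lit α)}
    (h : answerSet P X) : ∀ r ∈ P, ¬ defeated r X → r.bodyP ⊆ X → r.head ∈ X := by
  have := closedUnder_Th (reduct P X)
  rw [show Th (reduct P X) = X from h] at this
  exact closedUnder_reduct_iff.1 this

theorem answerSet.subset {α : Type} {P : Set (Rule α)} {X Z : Set (Lit α)}
    (h : answerSet P X) (hZ : ASP.logClosed Z)
    (hc : ∀ r ∈ P, ¬ defeated r X → r.bodyP ⊆ Z → r.head ∈ Z) : X ⊆ Z := by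
  rw [← show Th (reduct P X) = X from h]
  exact Set.sInter_subset_of_mem ⟨hZ, closedUnder_reduct_iff.2 hc⟩

theorem Lit.map_injective {α β : Type} {f : α → β} (hf : Function.Injective f) :
    Function.Injective (Lit.map f) := by
  rintro (a | a) (b | b) h
  · exact congrArg _ (hf (Lit.pos.inj h))
  · exact Lit.noConfusion rfl (heq_of_eq h)
  · exact Lit.noConfusion rfl (heq_of_eq h)
  · exact congrArg _ (hf (Lit.neg.inj h))

theorem oldLit_injective {α N : Type} : Function.Injective (oldLit (α := α) (N := N)) :=
  Lit.map_injective fun _ _ => TAtom.old.inj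

/-- Elimination principle for the rules of the translation. -/
theorem TTrans_cases {α N : Type} {P : Set (ORule α N)} {nm : ORule α N → N}
    {motive : Rule (TAtom α N) → Prop}
    (a1 : ∀ r ∈ P, motive (a1Rule nm r))
    (a2 : ∀ r ∈ P, motive (a2Rule nm r))
    (b1 : ∀ r ∈ P, ∀ L ∈ r.bodyP, motive (b1Rule nm r L))
    (b2 : ∀ r ∈ P, ∀ L ∈ r.bodyN, motive (b2Rule nm r L))
    (c1 : ∀ r ∈ P, motive (c1Rule P nm r))
    (c2 : ∀ r ∈ P, ∀ s ∈ P, motive (c2Rule nm r s))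
    (c3 : ∀ r ∈ P, ∀ s ∈ P, motive (c3Rule nm r s))
    (c4 : ∀ r ∈ P, ∀ s ∈ P, motive (c4Rule nm r s))
    (t : ∀ r ∈ P, ∀ s ∈ P, ∀ u ∈ P, motive (tRuleT nm r s u))
    (as : ∀ r ∈ P, ∀ s ∈ P, motive (asRuleT nm r s)) :
    ∀ ru ∈ TTrans P nm, motive ru := by
  rintro ru ⟨r, hr, (((((rfl | rfl | rfl) | ⟨L, hL, rfl⟩) | ⟨L, hL, rfl⟩) |
    ⟨s, hs, rfl | rfl | rfl⟩) | ⟨s, hs, u, hu, rfl⟩) | ⟨s, hs, rfl⟩⟩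
  exacts [a1 r hr, a2 r hr, c1 r hr, b1 r hr L hL, b2 r hr L hL, c2 r hr s hs, c3 r hr s hs,
    c4 r hr s hs, t r hr s hs u hu, as r hr s hs]

section Translation

variable {α N : Type} {P : Set (ORule α N)} {nm : ORule α N → N} {Y : Set (Lit (TAtom α N))}

/-! Membership of the individual rules in the translation. -/

theorem a1Rule_mem {r : ORule α N} (hr : r ∈ P) : a1Rule nm r ∈ TTrans P nm :=
  ⟨r, hr, by simp [tau]⟩

theorem a2Rule_mem {r : ORule α N} (hr : r ∈ P) : a2Rule nm r ∈ TTrans P nm :=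
  ⟨r, hr, by simp [tau]⟩

theorem c1Rule_mem {r : ORule α N} (hr : r ∈ P) : c1Rule P nm r ∈ TTrans P nm :=
  ⟨r, hr, by simp [tau]⟩

theorem b1Rule_mem {r : ORule α N} (hr : r ∈ P) {L : Lit (OAtom α N)} (hL : L ∈ r.bodyP) :
    b1Rule nm r L ∈ TTrans P nm :=
  ⟨r, hr, .inl (.inl (.inl (.inl (.inr ⟨L, hL, rfl⟩))))⟩

theorem b2Rule_mem {r : ORule α N} (hr : r ∈ P) {L : Lit (OAtom α N)} (hL : L ∈ r.bodyN) :
    b2Rule nm r L ∈ TTrans P nm :=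
  ⟨r, hr, .inl (.inl (.inl (.inr ⟨L, hL, rfl⟩)))⟩

theorem c2Rule_mem {r s : ORule α N} (hr : r ∈ P) (hs : s ∈ P) :
    c2Rule nm r s ∈ TTrans P nm :=
  ⟨r, hr, .inl (.inl (.inr ⟨s, hs, .inl rfl⟩))⟩

theorem c3Rule_mem {r s : ORule α N} (hr : r ∈ P) (hs : s ∈ P) :
    c3Rule nm r s ∈ TTrans P nm :=
  ⟨r, hr, .inl (.inl (.inr ⟨s, hs, .inr (.inl rfl)⟩))⟩

theorem c4Rule_mem {r s : ORule α N} (hr : r ∈ P) (hs : s ∈ P) :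
    c4Rule nm r s ∈ TTrans P nm :=
  ⟨r, hr, .inl (.inl (.inr ⟨s, hs, .inr (.inr rfl)⟩))⟩

theorem tRuleT_mem {r s t : ORule α N} (hr : r ∈ P) (hs : s ∈ P) (ht : t ∈ P) :
    tRuleT nm r s t ∈ TTrans P nm :=
  ⟨r, hr, .inl (.inr ⟨s, hs, t, ht, rfl⟩)⟩

theorem asRuleT_mem {r s : ORule α N} (hr : r ∈ P) (hs : s ∈ P) :
    asRuleT nm r s ∈ TTrans P nm :=
  ⟨r, hr, .inr ⟨s, hs, rfl⟩⟩

theorem not_defeated_of_bodyN_eq_empty {β : Type} {r : Rule β} (h : r.bodyN = ∅)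
    (X : Set (Lit β)) : ¬ defeated r X := by
  rintro ⟨L, hL, -⟩
  simp [h] at hL

/-- Without negation as failure no rule of the translation fires, so its answer sets are
consistent. -/
theorem answerSet.consistent_of_TTrans (hY : answerSet (TTrans P nm) Y) : consistent Y := by
  rcases hY.logClosed with h | rfl
  · exact h
  · refine consistent.mono (Y := ∅) (by rintro ⟨a, h, -⟩; exact h)
      (hY.subset (.inl (by rintro ⟨a, h, -⟩; exact h)) ?_)
    refine TTrans_cases ?_ ?_ ?_ ?_ ?_ ?_ ?_ ?_ ?_ ?_
    · exact fun r _ _ h => False.elim (h (Set.mem_singleton _))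
    · exact fun r _ _ h => False.elim (h (Set.mem_insert _ _))
    · exact fun r _ L _ _ h => False.elim (h (Set.mem_singleton _))
    · exact fun r _ L _ _ h => False.elim (h (Set.mem_insert _ _))
    · exact fun r hr _ h => False.elim (h ⟨r, hr, rfl⟩)
    · exact fun r _ s _ hd _ => hd ⟨_, Set.mem_singleton _, trivial⟩
    · exact fun r _ s _ _ h => False.elim (h (Set.mem_insert _ _))
    · exact fun r _ s _ _ h => False.elim (h (Set.mem_insert _ _))
    · exact fun r _ s _ u _ _ h => False.elim (h (Set.mem_insert _ _))
    · exact fun r _ s _ _ h => False.elim (h (Set.mem_singleton _))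

theorem answerSet.tpref_trans (hY : answerSet (TTrans P nm) Y) {r s t : ORule α N}
    (hr : r ∈ P) (hs : s ∈ P) (ht : t ∈ P) (hrs : tpref (nm r) (nm s) ∈ Y)
    (hst : tpref (nm s) (nm t) ∈ Y) : tpref (nm r) (nm t) ∈ Y :=
  hY.closed _ (tRuleT_mem hr hs ht) (not_defeated_of_bodyN_eq_empty rfl _)
    (Set.pair_subset hrs hst)

theorem answerSet.neg_tpref (hY : answerSet (TTrans P nm) Y) {r s : ORule α N}
    (hr : r ∈ P) (hs : s ∈ P) (hrs : tpref (nm r) (nm s) ∈ Y) :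
    Lit.neg (TAtom.old (OAtom.pref (nm s) (nm r))) ∈ Y :=
  hY.closed _ (asRuleT_mem hr hs) (not_defeated_of_bodyN_eq_empty rfl _)
    (Set.singleton_subset_iff.2 hrs)

theorem answerSet.apLit_mem (hY : answerSet (TTrans P nm) Y) {r : ORule α N} (hr : r ∈ P)
    (hok : okLit (nm r) ∈ Y) (hp : ∀ L ∈ r.bodyP, oldLit L ∈ Y)
    (hn : ∀ L ∈ r.bodyN, oldLit L ∉ Y) : apLit (nm r) ∈ Y := by
  refine hY.closed _ (a2Rule_mem hr) ?_ ?_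
  · rintro ⟨_, ⟨L, hL, rfl⟩, hLY⟩
    exact hn L hL hLY
  · exact Set.insert_subset hok (Set.image_subset_iff.2 hp)

theorem answerSet.head_mem (hY : answerSet (TTrans P nm) Y) {r : ORule α N} (hr : r ∈ P)
    (hap : apLit (nm r) ∈ Y) : oldLit r.head ∈ Y :=
  hY.closed _ (a1Rule_mem hr) (not_defeated_of_bodyN_eq_empty rfl _)
    (Set.singleton_subset_iff.2 hap)

theorem answerSet.apLit_or_blLit_mem (hY : answerSet (TTrans P nm) Y) {r : ORule α N}
    (hr : r ∈ P) (hok : okLit (nm r) ∈ Y) : apLit (nm r) ∈ Y ∨ blLit (nm r) ∈ Y := by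
  by_cases hp : ∀ L ∈ r.bodyP, oldLit L ∈ Y
  · by_cases hn : ∀ L ∈ r.bodyN, oldLit L ∉ Y
    · exact .inl (hY.apLit_mem hr hok hp hn)
    · push Not at hn
      obtain ⟨L, hL, hLY⟩ := hn
      exact .inr (hY.closed _ (b2Rule_mem hr hL) (not_defeated_of_bodyN_eq_empty rfl _)
        (Set.pair_subset hok hLY))
  · push Not at hp
    obtain ⟨L, hL, hLY⟩ := hp
    refine .inr (hY.closed _ (b1Rule_mem hr hL) ?_ (Set.singleton_subset_iff.2 hok))
    rintro ⟨_, rfl, h⟩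
    exact hLY h

/-- Every rule is eventually considered: `ok(n_r)` belongs to each answer set. -/
theorem answerSet.okLit_mem (hfin : P.Finite) (hY : answerSet (TTrans P nm) Y)
    {r : ORule α N} (hr : r ∈ P) : okLit (nm r) ∈ Y := by
  have hcons := hY.consistent_of_TTrans
  have : Finite P := hfin
  let lt : P → P → Prop := fun s r => tpref (nm r) (nm s) ∈ Y
  have : Std.Irrefl lt := ⟨fun s hs => hcons ⟨_, hs, hY.neg_tpref s.2 s.2 hs⟩⟩
  have : IsTrans P lt := ⟨fun a b c hab hbc => hY.tpref_trans c.2 b.2 a.2 hbc hab⟩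
  have hwf : WellFounded lt := Finite.wellFounded_of_trans_of_irrefl lt
  suffices ∀ r : P, okLit (nm r) ∈ Y from this ⟨r, hr⟩
  intro r
  induction r using hwf.induction with
  | _ r ih =>
    refine hY.closed _ (c1Rule_mem r.2) (not_defeated_of_bodyN_eq_empty rfl _) ?_
    rintro _ ⟨s, hs, rfl⟩
    by_cases hrs : tpref (nm r) (nm s) ∈ Y
    · rcases hY.apLit_or_blLit_mem hs (ih ⟨s, hs⟩ hrs) with h | h
      · exact hY.closed _ (c3Rule_mem r.2 hs) (not_defeated_of_bodyN_eq_empty rfl _)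
          (Set.pair_subset hrs h)
      · exact hY.closed _ (c4Rule_mem r.2 hs) (not_defeated_of_bodyN_eq_empty rfl _)
          (Set.pair_subset hrs h)
    · refine hY.closed _ (c2Rule_mem r.2 hs) ?_ (Set.empty_subset _)
      rintro ⟨_, rfl, h⟩
      exact hrs h

/-- The part of `Y` justified by `Z`: its `𝓛`-literals lie in `Z`, and its atoms `ap(n_r)`
belong to rules whose heads lie in `Z`. -/
def justified (P : Set (ORule α N)) (nm : ORule α N → N) (Y : Set (Lit (TAtom α N)))
    (Z : Set (Lit (OAtom α N))) : Set (Lit (TAtom α N)) :=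
  {K | K ∈ Y ∧ (∀ L, K = oldLit L → L ∈ Z) ∧ ∀ r ∈ P, K = apLit (nm r) → r.head ∈ Z}

theorem oldLit_mem_justified {Z : Set (Lit (OAtom α N))} {L : Lit (OAtom α N)}
    (hY : oldLit L ∈ Y) (hZ : L ∈ Z) : oldLit L ∈ justified P nm Y Z := by
  refine ⟨hY, fun K hK => oldLit_injective hK ▸ hZ, fun r _ h => ?_⟩
  cases L <;> simp [oldLit, Lit.map, apLit] at h

theorem mem_of_oldLit_mem_justified {Z : Set (Lit (OAtom α N))} {L : Lit (OAtom α N)}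
    (h : oldLit L ∈ justified P nm Y Z) : L ∈ Z :=
  h.2.1 L rfl

theorem aux_mem_justified {Z : Set (Lit (OAtom α N))} {K : Lit (TAtom α N)} (hK : K ∈ Y)
    (hold : ∀ a, K.atom ≠ TAtom.old a) (hap : ∀ n, K.atom ≠ TAtom.ap n) :
    K ∈ justified P nm Y Z := by
  refine ⟨hK, ?_, ?_⟩
  · rintro (a | a) rfl <;> exact absurd rfl (hold a)
  · rintro r _ rfl
    exact absurd rfl (hap (nm r))

theorem answerSet.subset_justified (hinj : Set.InjOn nm P) (hY : answerSet (TTrans P nm) Y)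
    {Z : Set (Lit (OAtom α N))}
    (hZ : ∀ r ∈ TA P nm, ¬ defeated r {L | oldLit L ∈ Y} → r.bodyP ⊆ Z → r.head ∈ Z) :
    Y ⊆ justified P nm Y Z := by
  have hsub : justified P nm Y Z ⊆ Y := fun _ h => h.1
  refine hY.subset (.inl (hY.consistent_of_TTrans.mono hsub)) ?_
  suffices h : ∀ ru ∈ TTrans P nm, ¬ defeated ru Y → ru.bodyP ⊆ justified P nm Y Z →
      ru.head ∈ Y → ru.head ∈ justified P nm Y Z from
    fun ru hru hd hb => h ru hru hd hb (hY.closed ru hru hd (hb.trans hsub))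
  refine TTrans_cases ?_ ?_ ?_ ?_ ?_ ?_ ?_ ?_ ?_ ?_
  · intro r hr _ hb hh
    exact oldLit_mem_justified hh ((hb (Set.mem_singleton _)).2.2 r hr rfl)
  · intro r hr hd hb hh
    refine ⟨hh, fun L hL => ?_, fun s hs hsr => ?_⟩
    · cases L <;> simp [a2Rule, oldLit, Lit.map, apLit] at hL
    · have hrs : nm r = nm s := by simpa [a2Rule, apLit] using hsr
      obtain rfl := hinj hr hs hrs
      refine hZ r (.inl (.inl hr)) ?_ fun L hL =>
        mem_of_oldLit_mem_justified (hb (.inr ⟨L, hL, rfl⟩))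
      rintro ⟨L, hL, hLY⟩
      exact hd ⟨_, ⟨L, hL, rfl⟩, hLY⟩
  iterate 2
    intro r _ L _ _ _ hh
    exact aux_mem_justified hh (fun _ => by simp [b1Rule, b2Rule, blLit, Lit.atom])
      (fun _ => by simp [b1Rule, b2Rule, blLit, Lit.atom])
  · intro r _ _ _ hh
    exact aux_mem_justified hh (fun _ => by simp [c1Rule, okLit, Lit.atom])
      (fun _ => by simp [c1Rule, okLit, Lit.atom])
  iterate 3
    intro r _ s _ _ _ hh
    exact aux_mem_justified hh (fun _ => by simp [c2Rule, c3Rule, c4Rule, rdyLit, Lit.atom])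
      (fun _ => by simp [c2Rule, c3Rule, c4Rule, rdyLit, Lit.atom])
  · intro r hr s hs u hu _ hb hh
    refine oldLit_mem_justified (L := prefLit (nm r) (nm u)) hh
      (hZ _ (.inl (.inr ⟨r, hr, s, hs, u, hu, rfl⟩)) (not_defeated_of_bodyN_eq_empty rfl _) ?_)
    refine Set.pair_subset ?_ ?_
    · exact mem_of_oldLit_mem_justified (hb (Set.mem_insert _ _))
    · exact mem_of_oldLit_mem_justified (hb (.inr rfl))
  · intro r hr s hs _ hb hh
    exact oldLit_mem_justified (L := Lit.neg (OAtom.pref (nm s) (nm r))) hh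
      (hZ _ (.inr ⟨r, hr, s, hs, rfl⟩) (not_defeated_of_bodyN_eq_empty rfl _)
        (Set.singleton_subset_iff.2 (mem_of_oldLit_mem_justified (hb (Set.mem_singleton _)))))

/-- The `𝓛`-part of an answer set of the translation is an answer set of `TA(Π)`. -/
theorem answerSet.answerSet_TA (hfin : P.Finite) (hinj : Set.InjOn nm P)
    (hY : answerSet (TTrans P nm) Y) : answerSet (TA P nm) {L | oldLit L ∈ Y} := by
  apply subset_antisymm
  · refine Set.sInter_subset_of_mem ⟨.inl ?_, closedUnder_reduct_iff.2 ?_⟩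
    · rintro ⟨a, hp, hn⟩
      exact hY.consistent_of_TTrans ⟨_, hp, hn⟩
    · rintro ru ((hr | ⟨r, hr, s, hs, t, ht, rfl⟩) | ⟨r, hr, s, hs, rfl⟩) hd hb
      · exact hY.head_mem hr (hY.apLit_mem hr (hY.okLit_mem hfin hr) hb
          fun L hL hLY => hd ⟨L, hL, hLY⟩)
      · exact hY.tpref_trans hr hs ht (hb (Set.mem_insert _ _)) (hb (.inr rfl))
      · exact hY.neg_tpref hr hs (hb (Set.mem_singleton _))
  · rintro L hL Z ⟨-, hZ⟩
    exact mem_of_oldLit_mem_justified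
      (hY.subset_justified hinj (closedUnder_reduct_iff.1 hZ) hL)

end Translation

theorem stmt11 {α N : Type} (P : Set (ORule α N)) (nm : ORule α N → N)
    (hfin : P.Finite) (hnm : Set.BijOn nm P Set.univ)
    (X : Set (Lit (OAtom α N)))
    (h : ∃ Y, answerSet (TTrans P nm) Y ∧
      Lit.map TAtom.old '' X = Y ∩ oldLitsT) :
    answerSet (TA P nm) X := by
  obtain ⟨Y, hY, hXY⟩ := h
  have hX : X = {L | oldLit L ∈ Y} := by
    ext L
    have hL : oldLit L ∈ oldLit '' X ↔ oldLit L ∈ Y ∩ oldLitsT := by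
      rw [← hXY]
      rfl
    rw [oldLit_injective.mem_set_image] at hL
    exact hL.trans (and_iff_left ⟨L, rfl⟩)
  exact hX ▸ hY.answerSet_TA hfin hnm.injOn

end ASP
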